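/- arXiv:1809.09662 — 4 statements merged into one kernel-verified Lean document; each statement's English description precedes it below -/
import Mathlib

section
/- There is an absolute constant C > 0 such that for all integers k ≥ 2 and n ≥ 3: | Σ_{n₁=1}^{n−1} (log n₁)^{k−2} / (n − n₁) − (log n)^{k−1} | ≤ C · k · (log n)^{k−2}. -/
noncomputable section

lemma sum_Icc_one_div_sub_eq_harmonic (N : ℕ) :
    ∑ j ∈ Finset.Icc 1 N, 1 / (((N + 1 : ℕ) : ℝ) - j) = (harmonic N : ℝ) := by
  rw [harmonic_eq_sum_Icc]
  push_cast
  refine Finset.sum_nbij' (fun j => N + 1 - j) (fun j => N + 1 - j) ?_ ?_ ?_ ?_ ?_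
  · intro j hj
    simp only [Finset.mem_Icc] at hj ⊢
    omega
  · intro j hj
    simp only [Finset.mem_Icc] at hj ⊢
    omega
  · intro j hj
    simp only [Finset.mem_Icc] at hj
    omega
  · intro j hj
    simp only [Finset.mem_Icc] at hj
    omega
  · intro j hj
    simp only [Finset.mem_Icc] at hj
    rw [Nat.cast_sub (by omega), one_div]
    push_cast
    rfl

lemma mul_pow_sub_pow_le {L l : ℝ} (hl : 0 ≤ l) (hL : l ≤ L) (m : ℕ) :
    L * (L ^ m - l ^ m) ≤ m * L ^ m * (L - l) := by
  induction m with
  | zero => simp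
  | succ m ih =>
    have h1 : l ^ m ≤ L ^ m := pow_le_pow_left₀ hl hL m
    have h2 := mul_le_mul_of_nonneg_left ih (hl.trans hL)
    have h3 := mul_nonneg (mul_nonneg (hl.trans hL) (sub_nonneg.2 hL)) (sub_nonneg.2 h1)
    push_cast
    simp only [pow_succ]
    nlinarith

/-- the elementary sum `∑_{n₁ < n} (log n₁)^{k-2}/(n - n₁) = (log n)^{k-1}
+ O(k (log n)^{k-2})`. -/
theorem statement_11 :
    ∃ C : ℝ, 0 < C ∧ ∀ k n : ℕ, 2 ≤ k → 3 ≤ n →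
      |(∑ n₁ ∈ Finset.Icc 1 (n - 1), Real.log n₁ ^ (k - 2) / ((n : ℝ) - n₁))
          - Real.log n ^ (k - 1)|
        ≤ C * k * Real.log n ^ (k - 2) := by
  refine ⟨2, two_pos, fun k n hk hn => ?_⟩
  obtain ⟨m, rfl⟩ := Nat.exists_eq_add_of_le' hk
  obtain ⟨N, rfl⟩ : ∃ N, n = N + 1 := ⟨n - 1, by omega⟩
  simp only [Nat.add_sub_cancel, show m + 2 - 1 = m + 1 from rfl]
  have hH := sum_Icc_one_div_sub_eq_harmonic N
  have hlow : Real.log ((N + 1 : ℕ) : ℝ) ≤ harmonic N := log_add_one_le_harmonic N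
  have hup : (harmonic N : ℝ) ≤ 1 + Real.log ((N + 1 : ℕ) : ℝ) :=
    (harmonic_le_one_add_log N).trans <| by
      gcongr
      · exact_mod_cast (by omega : 0 < N)
      · omega
  have hL1 : 1 ≤ Real.log ((N + 1 : ℕ) : ℝ) := by
    rw [Real.le_log_iff_exp_le (by positivity)]
    have h3 : (3 : ℝ) ≤ ((N + 1 : ℕ) : ℝ) := by exact_mod_cast hn
    linarith [Real.exp_one_lt_d9]
  have hlog : ∀ j ∈ Finset.Icc 1 N, 0 < (j : ℝ) ∧ 0 < ((N + 1 : ℕ) : ℝ) - j ∧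
      0 ≤ Real.log j ∧ Real.log j ≤ Real.log ((N + 1 : ℕ) : ℝ) := by
    intro j hj
    rw [Finset.mem_Icc] at hj
    have h0 : (0 : ℝ) < j := by exact_mod_cast hj.1
    have h1 : (j : ℝ) < ((N + 1 : ℕ) : ℝ) := by exact_mod_cast Nat.lt_succ_of_le hj.2
    exact ⟨h0, sub_pos.2 h1, Real.log_natCast_nonneg j, Real.log_le_log h0 h1.le⟩
  have hdiff : ∀ j ∈ Finset.Icc 1 N, Real.log ((N + 1 : ℕ) : ℝ) - Real.log j ≤
      (((N + 1 : ℕ) : ℝ) - j) / j := by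
    intro j hj
    obtain ⟨h0, -⟩ := hlog j hj
    rw [← Real.log_div (by positivity) h0.ne', sub_div, div_self h0.ne']
    exact Real.log_le_sub_one_of_pos (by positivity)
  generalize ((N + 1 : ℕ) : ℝ) = x at *
  generalize Real.log x = L at *
  have hLm : 0 < L ^ m := by positivity
  have hS_le : ∑ j ∈ Finset.Icc 1 N, Real.log j ^ m / (x - j) ≤ L ^ m * harmonic N := by
    rw [← hH, Finset.mul_sum]
    refine Finset.sum_le_sum fun j hj => ?_
    obtain ⟨-, h1, h2, h3⟩ := hlog j hj
    rw [mul_one_div]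
    gcongr
  have hS_ge : L * (L ^ m * harmonic N - ∑ j ∈ Finset.Icc 1 N, Real.log j ^ m / (x - j)) ≤
      m * L ^ m * harmonic N := by
    rw [← hH, Finset.mul_sum, ← Finset.sum_sub_distrib, Finset.mul_sum, hH,
      harmonic_eq_sum_Icc]
    push_cast
    rw [Finset.mul_sum]
    refine Finset.sum_le_sum fun j hj => ?_
    obtain ⟨h0, h1, h2, h3⟩ := hlog j hj
    calc L * (L ^ m * (1 / (x - j)) - Real.log j ^ m / (x - j))
        = L * (L ^ m - Real.log j ^ m) / (x - j) := by ring
      _ ≤ m * L ^ m * ((x - j) / j) / (x - j) := by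
          refine div_le_div_of_nonneg_right ((mul_pow_sub_pow_le h2 h3 m).trans ?_) h1.le
          exact mul_le_mul_of_nonneg_left (hdiff j hj) (by positivity)
      _ = m * L ^ m * (j : ℝ)⁻¹ := by field_simp
  generalize ∑ j ∈ Finset.Icc 1 N, Real.log j ^ m / (x - j) = S at *
  have hm : (0 : ℝ) ≤ m := m.cast_nonneg
  have hmL : 0 ≤ m * L ^ m := by positivity
  rw [abs_le]
  push_cast
  rw [pow_succ]
  constructor
  · have h1 : L * (L ^ m * harmonic N - S) ≤ L * (2 * (m * L ^ m)) := by
      nlinarith [mul_le_mul_of_nonneg_left (hup.trans (by linarith : 1 + L ≤ 2 * L)) hmL]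
    have h2 := le_of_mul_le_mul_left h1 (by linarith)
    nlinarith [mul_le_mul_of_nonneg_left hlow hLm.le]
  · nlinarith [mul_le_mul_of_nonneg_left hup hLm.le]

end
end

section
/- There is an absolute constant C > 0 with the following property. Let q ≥ 2 and d ≥ 1 be real numbers and let a, b be real numbers with |a| ≤ d and |b| ≤ d. For ℓ ≥ 1 and integers n ≥ 2 define B_ℓ(n) := ((−1)^ℓ/(ℓ−1)!) · (a^ℓ + (−1)^n b^ℓ) · q^{n/2}(log n)^{ℓ−1}/n. Then for all integers k ≥ 2 and n ≥ 4: | Σ_{n₁ + n₂ = n, n₁, n₂ ≥ 2} B_{k−1}(n₁) B_1(n₂) − ((−1)^k · k/(k−1)!) · (a^k + (−1)^n b^k) · q^{n/2}(log n)^{k−1}/n | ≤ C · d^k · k²/(k−1)! · q^{n/2}(log n)^{k−2}/n. -/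
noncomputable section

/-- The term `Z_ℓ(n) = ((-1)^ℓ/(ℓ-1)!) ∑_j m_j^ℓ α_j^n (log n)^{ℓ-1}/n`,
where `α_j = √q e^{iγ_j}`. -/
def Zfun (q : ℝ) {D : ℕ} (γ : Fin D → ℝ) (m : Fin D → ℕ) (ℓ n : ℕ) : ℂ :=
  ((-1 : ℂ) ^ ℓ / (Nat.factorial (ℓ - 1) : ℂ)) *
    ∑ j, (m j : ℂ) ^ ℓ * ((Real.sqrt q : ℂ) * Complex.exp (Complex.I * (γ j : ℂ))) ^ n *
      (Real.log n : ℂ) ^ (ℓ - 1) / (n : ℂ)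

/-- The term `B_ℓ(n) = ((-1)^ℓ/(ℓ-1)!) (a^ℓ + (-1)^n b^ℓ) q^{n/2} (log n)^{ℓ-1}/n`. -/
def Bfun (q a b : ℝ) (ℓ n : ℕ) : ℝ :=
  ((-1 : ℝ) ^ ℓ / (Nat.factorial (ℓ - 1) : ℝ)) * (a ^ ℓ + (-1 : ℝ) ^ n * b ^ ℓ) *
    Real.sqrt q ^ n * Real.log n ^ (ℓ - 1) / n

/-- `γ`: the minimum of the quantities `|γ_i - γ_j|` (`i ≠ j`), `|γ_i|`, `|π - γ_i|`. -/
def angleGap {D : ℕ} (γ : Fin D → ℝ) : ℝ :=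
  sInf ({x | ∃ i j, i ≠ j ∧ x = |γ i - γ j|} ∪ {x | ∃ i, x = |γ i|}
    ∪ {x | ∃ i, x = |Real.pi - γ i|})

/-- The mean value inequality for `x ↦ x ^ (m + 1)`. -/
theorem pow_succ_sub_pow_succ_mem_Icc (m : ℕ) {u v : ℝ} (hu : 0 ≤ u) (huv : u ≤ v) :
    v ^ (m + 1) - u ^ (m + 1) ∈
      Set.Icc ((m + 1) * u ^ m * (v - u)) ((m + 1) * v ^ m * (v - u)) := by
  have hv : 0 ≤ v := hu.trans huv
  induction m with
  | zero => simp
  | succ m ih =>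
    obtain ⟨h1, h2⟩ := ih
    have hp : u ^ (m + 1) ≤ v ^ (m + 1) := pow_le_pow_left₀ hu huv _
    have hvu : 0 ≤ v - u := sub_nonneg.2 huv
    have e1 : v ^ (m + 1 + 1) - u ^ (m + 1 + 1)
        = u * (v ^ (m + 1) - u ^ (m + 1)) + v ^ (m + 1) * (v - u) := by ring
    have e2 : v ^ (m + 1 + 1) - u ^ (m + 1 + 1)
        = v * (v ^ (m + 1) - u ^ (m + 1)) + u ^ (m + 1) * (v - u) := by ring
    have h3 := mul_le_mul_of_nonneg_left h1 hu
    have h4 := mul_le_mul_of_nonneg_left h2 hv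
    have h5 := mul_le_mul_of_nonneg_right hp hvu
    push_cast
    constructor
    · rw [e1]
      calc _ = u * ((m + 1) * u ^ m * (v - u)) + u ^ (m + 1) * (v - u) := by ring
        _ ≤ _ := by linarith
    · rw [e2]
      calc _ ≤ v * ((m + 1) * v ^ m * (v - u)) + v ^ (m + 1) * (v - u) := by linarith
        _ = _ := by ring

/-- A Lipschitz-type bound for the powers of the logarithm on `[1, z]`. -/
theorem log_pow_sub_log_pow_le (m : ℕ) {x y z : ℝ} (hx : 1 ≤ x) (hxy : x ≤ y) (hyz : y ≤ z) :
    Real.log y ^ m - Real.log x ^ m ≤ m * Real.log z ^ (m - 1) * ((y - x) / x) := by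
  have hx0 : 0 < x := by linarith
  have hy0 : 0 < y := by linarith
  have hlx : 0 ≤ Real.log x := Real.log_nonneg hx
  have hlxy : Real.log x ≤ Real.log y := Real.log_le_log hx0 hxy
  have hlyz : Real.log y ≤ Real.log z := Real.log_le_log hy0 hyz
  have hd : Real.log y - Real.log x ≤ (y - x) / x := by
    rw [← Real.log_div hy0.ne' hx0.ne', sub_div, div_self hx0.ne']
    exact Real.log_le_sub_one_of_pos (by positivity)
  cases m with
  | zero => simp
  | succ m =>
    refine (pow_succ_sub_pow_succ_mem_Icc m hlx hlxy).2.trans ?_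
    have : 0 ≤ Real.log z := by linarith
    push_cast
    have := sub_nonneg.2 hlxy
    have : 0 ≤ Real.log y := by linarith
    gcongr

theorem natCast_mul_pow_pred_le (m : ℕ) {L : ℝ} (hL : 1 ≤ L) :
    m * L ^ (m - 1) ≤ m * L ^ m := by
  gcongr
  omega

theorem one_le_log_natCast {n : ℕ} (hn : 4 ≤ n) : 1 ≤ Real.log n := by
  rw [Real.le_log_iff_exp_le (by positivity)]
  have := Real.exp_one_lt_d9
  have : (4 : ℝ) ≤ n := by exact_mod_cast hn
  linarith

theorem sum_Ico_two_inv_sq_le (M : ℕ) : ∑ j ∈ Finset.Ico 2 M, 1 / (j : ℝ) ^ 2 ≤ 1 := by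
  rcases Nat.lt_or_ge M 2 with h | h
  · simp [Finset.Ico_eq_empty_of_le h.le]
  suffices hs : ∑ j ∈ Finset.Ico 2 M, 1 / (j : ℝ) ^ 2 ≤ 1 - 1 / ((M : ℝ) - 1) by
    have : (2 : ℝ) ≤ M := by exact_mod_cast h
    have : 0 ≤ 1 / ((M : ℝ) - 1) := one_div_nonneg.2 (by linarith)
    linarith
  induction M, h using Nat.le_induction with
  | base => norm_num
  | succ M h ih =>
    rw [Finset.sum_Ico_succ_top h]
    have h2 : (2 : ℝ) ≤ M := by exact_mod_cast h
    have h3 : (0 : ℝ) < M - 1 := by linarith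
    have : 1 / (M : ℝ) ^ 2 ≤ 1 / ((M : ℝ) - 1) - 1 / M := by
      rw [div_sub_div _ _ h3.ne' (by positivity), div_le_div_iff₀ (by positivity) (by positivity)]
      nlinarith
    push_cast
    rw [add_sub_cancel_right]
    linarith

/-- Reflection `j ↦ n - j` of a sum over `2 ≤ j ≤ n - 2`. -/
theorem sum_Ico_two_reflect (f : ℝ → ℝ) {n : ℕ} (hn : 4 ≤ n) :
    ∑ j ∈ Finset.Ico 2 (n - 1), f ((n : ℝ) - j) = ∑ j ∈ Finset.Ico 2 (n - 1), f j := by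
  have h := Finset.sum_Ico_reflect (fun j : ℕ => f j) 2 (m := n - 1) (n := n) (by omega)
  rw [show n + 1 - (n - 1) = 2 by omega, show n + 1 - 2 = n - 1 by omega] at h
  rw [← h]
  refine Finset.sum_congr rfl fun j hj => ?_
  rw [Finset.mem_Ico] at hj
  rw [Nat.cast_sub (by omega)]

/-- Comparison of `∑ (log j)^m / j` with the corresponding integral. -/
theorem abs_sum_log_pow_div_sub_le (m : ℕ) {n : ℕ} (hn : 4 ≤ n) :
    |∑ j ∈ Finset.Ico 2 (n - 1), Real.log j ^ m / j - Real.log n ^ (m + 1) / (m + 1)|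
      ≤ 4 * (m + 1) * Real.log n ^ m := by
  set L := Real.log n
  have hL : 1 ≤ L := one_le_log_natCast hn
  have hLm : 1 ≤ L ^ m := one_le_pow₀ hL
  have hn' : (4 : ℝ) ≤ n := by exact_mod_cast hn
  have hm : (0 : ℝ) ≤ m := m.cast_nonneg
  let G : ℕ → ℝ := fun j => Real.log j ^ (m + 1) / (m + 1)
  have hG : ∀ j : ℕ, 1 ≤ j → j + 1 ≤ n →
      |Real.log j ^ m / j - (G (j + 1) - G j)| ≤ (m + 1) * L ^ m * (1 / (j : ℝ) ^ 2) := by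
    intro j hj hjn
    have hj1 : (1 : ℝ) ≤ j := by exact_mod_cast hj
    have hj0 : (0 : ℝ) < j := by linarith
    have hjn' : (j : ℝ) + 1 ≤ n := by exact_mod_cast hjn
    have hu : 0 ≤ Real.log j := Real.log_nonneg hj1
    have huv : Real.log j ≤ Real.log ((j : ℝ) + 1) := Real.log_le_log hj0 (by linarith)
    have hvL : Real.log ((j : ℝ) + 1) ≤ L := Real.log_le_log (by linarith) hjn'
    obtain ⟨h1, h2⟩ := pow_succ_sub_pow_succ_mem_Icc m hu huv
    have hGe : (m + 1) * (G (j + 1) - G j)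
        = Real.log ((j : ℝ) + 1) ^ (m + 1) - Real.log j ^ (m + 1) := by
      simp only [G]
      push_cast
      field_simp
    rw [← hGe, mul_assoc] at h1 h2
    have hm1 : (0 : ℝ) < m + 1 := by linarith
    have h1 := le_of_mul_le_mul_left h1 hm1
    have h2 := le_of_mul_le_mul_left h2 hm1
    have hlog : Real.log ((j : ℝ) + 1) - Real.log j ≤ 1 / j := by
      rw [← Real.log_div (by positivity) hj0.ne', add_div, div_self hj0.ne']
      have := Real.log_le_sub_one_of_pos (x := 1 + 1 / (j : ℝ)) (by positivity)
      linarith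
    have hlog' : 1 / ((j : ℝ) + 1) ≤ Real.log ((j : ℝ) + 1) - Real.log j := by
      rw [← Real.log_div (by positivity) hj0.ne']
      refine le_trans (le_of_eq ?_) (Real.one_sub_inv_le_log_of_pos (by positivity))
      field_simp
      ring
    have hpow := log_pow_sub_log_pow_le m hj1 (by linarith : (j : ℝ) ≤ j + 1) hjn'
    rw [add_sub_cancel_left] at hpow
    have hpow' : Real.log ((j : ℝ) + 1) ^ m ≤ Real.log j ^ m + m * L ^ m * (1 / j) := by
      have := mul_le_mul_of_nonneg_right (natCast_mul_pow_pred_le m hL) (one_div_nonneg.2 hj0.le)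
      linarith
    have huL : Real.log j ^ m ≤ L ^ m := pow_le_pow_left₀ hu (huv.trans hvL) m
    have hum : 0 ≤ Real.log j ^ m := pow_nonneg hu m
    have hvm : 0 ≤ Real.log ((j : ℝ) + 1) ^ m := pow_nonneg (hu.trans huv) m
    have hsq : 0 ≤ L ^ m * (1 / (j : ℝ) ^ 2) := by positivity
    have hmsq : 0 ≤ m * (L ^ m * (1 / (j : ℝ) ^ 2)) := by positivity
    rw [abs_le]
    constructor
    · have h3 := mul_le_mul_of_nonneg_left hlog hvm
      have h4 := mul_le_mul_of_nonneg_right hpow' (one_div_nonneg.2 hj0.le)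
      have h5 : (Real.log j ^ m + m * L ^ m * (1 / j)) * (1 / j)
          = Real.log j ^ m / j + m * (L ^ m * (1 / (j : ℝ) ^ 2)) := by
        field_simp
      linarith
    · have h3 := mul_le_mul_of_nonneg_left hlog' hum
      have h4 : 1 / (j : ℝ) - 1 / (j + 1) ≤ 1 / (j : ℝ) ^ 2 := by
        rw [div_sub_div _ _ hj0.ne' (by positivity),
          div_le_div_iff₀ (by positivity) (by positivity)]
        nlinarith
      have h5 := mul_le_mul_of_nonneg_left h4 hum
      have h6 := mul_le_mul_of_nonneg_right huL (by positivity : (0 : ℝ) ≤ 1 / (j : ℝ) ^ 2)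
      have h7 : Real.log j ^ m / j = Real.log j ^ m * (1 / j) := by ring
      rw [h7]
      linarith
  have htel : ∑ j ∈ Finset.Ico 2 (n - 1), (G (j + 1) - G j) = G (n - 1) - G 2 :=
    Finset.sum_Ico_sub G (by omega)
  have hsum : |∑ j ∈ Finset.Ico 2 (n - 1), Real.log j ^ m / j - (G (n - 1) - G 2)|
      ≤ (m + 1) * L ^ m := by
    rw [← htel, ← Finset.sum_sub_distrib]
    refine (Finset.abs_sum_le_sum_abs _ _).trans ?_
    calc _ ≤ ∑ j ∈ Finset.Ico 2 (n - 1), (m + 1) * L ^ m * (1 / (j : ℝ) ^ 2) := by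
          refine Finset.sum_le_sum fun j hj => ?_
          rw [Finset.mem_Ico] at hj
          exact hG j (by omega) (by omega)
      _ = (m + 1) * L ^ m * ∑ j ∈ Finset.Ico 2 (n - 1), 1 / (j : ℝ) ^ 2 := by
          rw [Finset.mul_sum]
      _ ≤ (m + 1) * L ^ m * 1 := by
          gcongr
          exact sum_Ico_two_inv_sq_le _
      _ = _ := mul_one _
  have hlast : |G n - G (n - 1)| ≤ 2 * (m + 1) * L ^ m := by
    have h := hG (n - 1) (by omega) (by omega)
    have hc : ((n - 1 : ℕ) : ℝ) = n - 1 := by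
      rw [Nat.cast_sub (by omega), Nat.cast_one]
    rw [Nat.sub_add_cancel (by omega : 1 ≤ n), hc] at h
    have h3 : (1 : ℝ) ≤ n - 1 := by linarith
    have hlo : 0 ≤ Real.log ((n : ℝ) - 1) := Real.log_nonneg h3
    have hlL : Real.log ((n : ℝ) - 1) ^ m ≤ L ^ m :=
      pow_le_pow_left₀ hlo (Real.log_le_log (by linarith) (by linarith)) m
    have h4 : Real.log ((n : ℝ) - 1) ^ m / (n - 1) ≤ L ^ m :=
      (div_le_self (pow_nonneg hlo m) h3).trans hlL
    have h5 : 0 ≤ Real.log ((n : ℝ) - 1) ^ m / (n - 1) :=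
      div_nonneg (pow_nonneg hlo m) (by linarith)
    have h6 : (m + 1) * L ^ m * (1 / ((n : ℝ) - 1) ^ 2) ≤ (m + 1) * L ^ m :=
      mul_le_of_le_one_right (by positivity) (by
        rw [div_le_one (by positivity)]
        nlinarith)
    have h7 : 0 ≤ m * L ^ m := by positivity
    rw [abs_le] at h ⊢
    constructor <;> linarith [h.1, h.2]
  have htwo : |G 2| ≤ L ^ m := by
    have h2 : 0 ≤ Real.log 2 := Real.log_nonneg (by norm_num)
    have h3 : Real.log 2 ≤ 1 := by linarith [Real.log_two_lt_d9]
    simp only [G, Nat.cast_ofNat]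
    rw [abs_of_nonneg (by positivity)]
    exact ((div_le_self (by positivity) (by linarith)).trans (pow_le_one₀ h2 h3)).trans hLm
  have hGn : L ^ (m + 1) / (m + 1) = G n := rfl
  have h7 : 0 ≤ m * L ^ m := by positivity
  rw [hGn]
  rw [abs_le] at hsum hlast htwo ⊢
  constructor <;> linarith [hsum.1, hsum.2, hlast.1, hlast.2, htwo.1, htwo.2]

theorem abs_sum_log_pow_div_reflect_sub_le (m : ℕ) {n : ℕ} (hn : 4 ≤ n) :
    |∑ j ∈ Finset.Ico 2 (n - 1), Real.log j ^ m / ((n : ℝ) - j) - Real.log n ^ (m + 1)|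
      ≤ 5 * (m + 1) * Real.log n ^ m := by
  have hL : 1 ≤ Real.log n := one_le_log_natCast hn
  have hH := abs_sum_log_pow_div_sub_le 0 hn
  simp only [pow_zero, Nat.cast_zero, zero_add, pow_one, div_one, mul_one] at hH
  have hR := sum_Ico_two_reflect (fun x => 1 / x) hn
  set L := Real.log n
  set H := ∑ j ∈ Finset.Ico 2 (n - 1), 1 / (j : ℝ)
  have hm : (0 : ℝ) ≤ m := m.cast_nonneg
  have hE : ∑ j ∈ Finset.Ico 2 (n - 1), Real.log j ^ m / ((n : ℝ) - j)
      = L ^ m * H - ∑ j ∈ Finset.Ico 2 (n - 1), (L ^ m - Real.log j ^ m) / ((n : ℝ) - j) := by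
    rw [← hR, Finset.mul_sum, ← Finset.sum_sub_distrib]
    exact Finset.sum_congr rfl fun j _ => by ring
  have hterm : ∀ j ∈ Finset.Ico 2 (n - 1),
      0 ≤ (L ^ m - Real.log j ^ m) / ((n : ℝ) - j) ∧
      (L ^ m - Real.log j ^ m) / ((n : ℝ) - j) ≤ m * L ^ (m - 1) * (1 / j) := by
    intro j hj
    rw [Finset.mem_Ico] at hj
    have hj1 : (1 : ℝ) ≤ j := by exact_mod_cast (by omega : 1 ≤ j)
    have hjn : (j : ℝ) < n := by exact_mod_cast (by omega : j < n)
    have hd : (0 : ℝ) < n - j := by linarith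
    have hj0 : (0 : ℝ) < j := by linarith
    constructor
    · refine div_nonneg (sub_nonneg.2 ?_) hd.le
      exact pow_le_pow_left₀ (Real.log_nonneg hj1) (Real.log_le_log hj0 hjn.le) m
    · rw [div_le_iff₀ hd]
      refine (log_pow_sub_log_pow_le m hj1 hjn.le le_rfl).trans (le_of_eq ?_)
      ring
  have hD0 : 0 ≤ ∑ j ∈ Finset.Ico 2 (n - 1), (L ^ m - Real.log j ^ m) / ((n : ℝ) - j) :=
    Finset.sum_nonneg fun j hj => (hterm j hj).1
  have hD1 : ∑ j ∈ Finset.Ico 2 (n - 1), (L ^ m - Real.log j ^ m) / ((n : ℝ) - j)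
      ≤ 5 * (m * L ^ m) := by
    calc _ ≤ ∑ j ∈ Finset.Ico 2 (n - 1), m * L ^ (m - 1) * (1 / (j : ℝ)) :=
          Finset.sum_le_sum fun j hj => (hterm j hj).2
      _ = m * L ^ (m - 1) * H := by rw [Finset.mul_sum]
      _ ≤ m * L ^ (m - 1) * (5 * L) := by
          gcongr
          linarith [(abs_le.1 hH).2]
      _ = 5 * (m * L ^ m) := by
          cases m with
          | zero => simp
          | succ m => rw [Nat.add_sub_cancel]; ring
  have hmain : |L ^ m * H - L ^ (m + 1)| ≤ 4 * L ^ m := by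
    rw [show L ^ m * H - L ^ (m + 1) = L ^ m * (H - L) by ring, abs_mul,
      abs_of_nonneg (by positivity : 0 ≤ L ^ m), mul_comm]
    gcongr
  rw [hE]
  rw [abs_le] at hmain ⊢
  constructor <;> linarith [hmain.1, hmain.2]

/-- An alternating sum is controlled by the variation of its terms. -/
theorem two_mul_abs_alternating_sum_le (f : ℕ → ℝ) {s M : ℕ} (h : s ≤ M) :
    2 * |∑ j ∈ Finset.Ico s M, (-1 : ℝ) ^ j * f j|
      ≤ |f s| + |f M| + ∑ j ∈ Finset.Ico s M, |f j - f (j + 1)| := by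
  have htel : ∑ j ∈ Finset.Ico s M, ((-1 : ℝ) ^ (j + 1) * f (j + 1) - (-1 : ℝ) ^ j * f j)
      = (-1 : ℝ) ^ M * f M - (-1 : ℝ) ^ s * f s :=
    Finset.sum_Ico_sub (fun j => (-1 : ℝ) ^ j * f j) h
  have hE : 2 * ∑ j ∈ Finset.Ico s M, (-1 : ℝ) ^ j * f j
      = (-1 : ℝ) ^ s * f s - (-1 : ℝ) ^ M * f M
        + ∑ j ∈ Finset.Ico s M, (-1 : ℝ) ^ j * (f j - f (j + 1)) := by
    rw [← neg_sub ((-1 : ℝ) ^ M * f M), ← htel, ← Finset.sum_neg_distrib,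
      ← Finset.sum_add_distrib, Finset.mul_sum]
    exact Finset.sum_congr rfl fun j _ => by ring
  have hsgn : ∀ (i : ℕ) (x : ℝ), |(-1 : ℝ) ^ i * x| = |x| := fun i x => by
    rw [abs_mul, abs_pow, abs_neg, abs_one, one_pow, one_mul]
  have h2 : 2 * |∑ j ∈ Finset.Ico s M, (-1 : ℝ) ^ j * f j|
      = |2 * ∑ j ∈ Finset.Ico s M, (-1 : ℝ) ^ j * f j| := by
    rw [abs_mul, abs_two]
  rw [h2, hE]
  refine (abs_add_le _ _).trans (add_le_add ?_ ?_)
  · refine (abs_sub _ _).trans ?_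
    rw [hsgn, hsgn]
  · refine (Finset.abs_sum_le_sum_abs _ _).trans (le_of_eq ?_)
    exact Finset.sum_congr rfl fun j _ => hsgn _ _

theorem abs_alternating_sum_log_pow_le (m : ℕ) {n : ℕ} (hn : 4 ≤ n) :
    |∑ j ∈ Finset.Ico 2 (n - 1),
        (-1 : ℝ) ^ j * (Real.log j ^ m * (1 / (j : ℝ) + 1 / ((n : ℝ) - j)))|
      ≤ 4 * (m + 1) * Real.log n ^ m := by
  have hL : 1 ≤ Real.log n := one_le_log_natCast hn
  have hR := sum_Ico_two_reflect (fun x => 1 / x ^ 2) hn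
  have hQ := sum_Ico_two_inv_sq_le (n - 1)
  set L := Real.log n
  have hLm : 1 ≤ L ^ m := one_le_pow₀ hL
  have hm : (0 : ℝ) ≤ m := m.cast_nonneg
  let F : ℕ → ℝ := fun j => Real.log j ^ m * (1 / (j : ℝ) + 1 / ((n : ℝ) - j))
  have hF : ∀ j : ℕ, 1 ≤ j → j + 1 ≤ n → |F j| ≤ 2 * L ^ m := by
    intro j hj hjn
    have hj1 : (1 : ℝ) ≤ j := by exact_mod_cast hj
    have hjn' : (j : ℝ) + 1 ≤ n := by exact_mod_cast hjn
    have hd : (1 : ℝ) ≤ n - j := by linarith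
    have hu : 0 ≤ Real.log j := Real.log_nonneg hj1
    have huL : Real.log j ^ m ≤ L ^ m :=
      pow_le_pow_left₀ hu (Real.log_le_log (by linarith) (by linarith)) m
    have h1 : 1 / (j : ℝ) ≤ 1 := (div_le_one (by linarith)).2 hj1
    have h2 : 1 / ((n : ℝ) - j) ≤ 1 := (div_le_one (by linarith)).2 hd
    have h3 : 0 ≤ 1 / (j : ℝ) + 1 / ((n : ℝ) - j) :=
      add_nonneg (one_div_nonneg.2 (by linarith)) (one_div_nonneg.2 (by linarith))
    rw [abs_of_nonneg (mul_nonneg (pow_nonneg hu m) h3), mul_comm 2]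
    exact mul_le_mul huL (by linarith) h3 (by linarith)
  have hV : ∀ j ∈ Finset.Ico 2 (n - 1), |F j - F (j + 1)|
      ≤ 2 * (m + 1) * L ^ m * (1 / (j : ℝ) ^ 2 + 1 / ((n : ℝ) - j) ^ 2) := by
    intro j hj
    rw [Finset.mem_Ico] at hj
    have hj1 : (1 : ℝ) ≤ j := by exact_mod_cast (by omega : 1 ≤ j)
    have hj0 : (0 : ℝ) < j := by linarith
    have hjn : (j : ℝ) + 2 ≤ n := by exact_mod_cast (by omega : j + 2 ≤ n)
    obtain ⟨i, hi⟩ : ∃ i : ℝ, i = n - j := ⟨_, rfl⟩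
    have hi2 : 2 ≤ i := by linarith
    have hi0 : 0 < i := by linarith
    have hi1 : 0 < i - 1 := by linarith
    have hu : 0 ≤ Real.log j := Real.log_nonneg hj1
    have huv : Real.log j ≤ Real.log ((j : ℝ) + 1) := Real.log_le_log hj0 (by linarith)
    have hvL : Real.log ((j : ℝ) + 1) ≤ L := Real.log_le_log (by linarith) (by linarith)
    have hpow := log_pow_sub_log_pow_le m hj1 (by linarith : (j : ℝ) ≤ j + 1)
      (by linarith : (j : ℝ) + 1 ≤ n)
    rw [add_sub_cancel_left] at hpow
    have hpow' : Real.log ((j : ℝ) + 1) ^ m - Real.log j ^ m ≤ m * L ^ m * (1 / j) :=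
      hpow.trans (mul_le_mul_of_nonneg_right (natCast_mul_pow_pred_le m hL) (by positivity))
    have hpow0 : 0 ≤ Real.log ((j : ℝ) + 1) ^ m - Real.log j ^ m :=
      sub_nonneg.2 (pow_le_pow_left₀ hu huv m)
    have hvm : Real.log ((j : ℝ) + 1) ^ m ≤ L ^ m := pow_le_pow_left₀ (hu.trans huv) hvL m
    have hvm0 : 0 ≤ Real.log ((j : ℝ) + 1) ^ m := pow_nonneg (hu.trans huv) m
    have hFe : F j - F (j + 1)
        = -((Real.log ((j : ℝ) + 1) ^ m - Real.log j ^ m) * (1 / j + 1 / i))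
          + Real.log ((j : ℝ) + 1) ^ m * (1 / (j * (j + 1)) - 1 / (i * (i - 1))) := by
      have e1 : 1 / ((j : ℝ) * (j + 1)) = 1 / j - 1 / (j + 1) := by
        field_simp
        ring
      have e2 : 1 / (i * (i - 1)) = 1 / (i - 1) - 1 / i := by
        field_simp
        ring
      have e3 : (n : ℝ) - (j + 1) = i - 1 := by rw [hi]; ring
      simp only [F]
      push_cast
      rw [e1, e2, e3, ← hi]
      ring
    have hA : (Real.log ((j : ℝ) + 1) ^ m - Real.log j ^ m) * (1 / j + 1 / i)
        ≤ 2 * m * L ^ m * (1 / (j : ℝ) ^ 2 + 1 / i ^ 2) := by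
      have h1 := mul_le_mul_of_nonneg_right hpow' (by positivity : 0 ≤ 1 / (j : ℝ) + 1 / i)
      have h2 : 1 / (j : ℝ) * (1 / j + 1 / i) ≤ 2 * (1 / (j : ℝ) ^ 2 + 1 / i ^ 2) := by
        have e1 : 1 / (j : ℝ) ^ 2 = (1 / j) ^ 2 := by ring
        have e2 : 1 / i ^ 2 = (1 / i) ^ 2 := by ring
        rw [e1, e2]
        nlinarith [sq_nonneg (1 / (j : ℝ) - 1 / i), sq_nonneg (1 / (j : ℝ)), sq_nonneg (1 / i)]
      have h3 := mul_le_mul_of_nonneg_left h2 (by positivity : 0 ≤ m * L ^ m)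
      linarith
    have hA0 : 0 ≤ (Real.log ((j : ℝ) + 1) ^ m - Real.log j ^ m) * (1 / j + 1 / i) := by
      positivity
    have hB1 : 1 / ((j : ℝ) * (j + 1)) ≤ 1 / (j : ℝ) ^ 2 :=
      one_div_le_one_div_of_le (by positivity) (by nlinarith)
    have hB2 : 1 / (i * (i - 1)) ≤ 2 * (1 / i ^ 2) := by
      rw [mul_one_div, div_le_div_iff₀ (by positivity) (by positivity)]
      nlinarith
    have hB1' : 0 ≤ 1 / ((j : ℝ) * (j + 1)) := by positivity
    have hB2' : 0 ≤ 1 / (i * (i - 1)) := by positivity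
    have hjq : 0 ≤ 1 / (j : ℝ) ^ 2 := by positivity
    have hiq : 0 ≤ 1 / i ^ 2 := by positivity
    have hB : |Real.log ((j : ℝ) + 1) ^ m * (1 / (j * (j + 1)) - 1 / (i * (i - 1)))|
        ≤ L ^ m * (2 * (1 / (j : ℝ) ^ 2 + 1 / i ^ 2)) := by
      rw [abs_mul, abs_of_nonneg hvm0]
      refine mul_le_mul hvm (abs_le.2 ⟨?_, ?_⟩) (abs_nonneg _) (by linarith) <;> linarith
    rw [← hi, hFe]
    refine (abs_add_le _ _).trans ?_
    rw [abs_neg, abs_of_nonneg hA0]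
    linarith
  have hsum : ∑ j ∈ Finset.Ico 2 (n - 1), |F j - F (j + 1)| ≤ 4 * (m + 1) * L ^ m := by
    calc _ ≤ ∑ j ∈ Finset.Ico 2 (n - 1),
          2 * (m + 1) * L ^ m * (1 / (j : ℝ) ^ 2 + 1 / ((n : ℝ) - j) ^ 2) :=
          Finset.sum_le_sum hV
      _ = 2 * (m + 1) * L ^ m * (2 * ∑ j ∈ Finset.Ico 2 (n - 1), 1 / (j : ℝ) ^ 2) := by
          rw [← Finset.mul_sum, Finset.sum_add_distrib, hR, two_mul (Finset.sum _ _)]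
      _ ≤ 2 * (m + 1) * L ^ m * (2 * 1) := by gcongr
      _ = _ := by ring
  have h := two_mul_abs_alternating_sum_le F (by omega : 2 ≤ n - 1)
  have h1 := hF 2 (by omega) (by omega)
  have h2 := hF (n - 1) (by omega) (by omega)
  have h7 : 0 ≤ m * L ^ m := by positivity
  linarith

/-- The convolution over ordered pairs as a sum over the first summand. -/
theorem sum_filter_add_eq_sum_Ico (f : ℕ → ℕ → ℝ) (n : ℕ) :
    ∑ p ∈ (Finset.Icc 2 n ×ˢ Finset.Icc 2 n).filter (fun p => p.1 + p.2 = n), f p.1 p.2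
      = ∑ j ∈ Finset.Ico 2 (n - 1), f j (n - j) := by
  refine Finset.sum_bij' (fun p _ => p.1) (fun j _ => (j, n - j)) ?_ ?_ ?_ ?_ ?_
  · rintro ⟨x, y⟩ h
    simp only [Finset.mem_filter, Finset.mem_product, Finset.mem_Icc, Finset.mem_Ico] at h ⊢
    omega
  · intro j h
    simp only [Finset.mem_filter, Finset.mem_product, Finset.mem_Icc, Finset.mem_Ico] at h ⊢
    omega
  · rintro ⟨x, y⟩ h
    simp only [Finset.mem_filter, Finset.mem_product, Finset.mem_Icc] at h
    simp only [Prod.mk.injEq, true_and]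
    omega
  · intro j _
    rfl
  · rintro ⟨x, y⟩ h
    simp only [Finset.mem_filter, Finset.mem_product, Finset.mem_Icc] at h
    rw [show n - x = y by omega]

theorem Bfun_mul_Bfun_one (q a b : ℝ) (m : ℕ) {n j : ℕ} (hj : 0 < j) (hjn : j < n) :
    Bfun q a b (m + 1) j * Bfun q a b 1 (n - j)
      = (-1 : ℝ) ^ m / (Nat.factorial m : ℝ) * Real.sqrt q ^ n / n *
        ((a ^ (m + 2) + (-1 : ℝ) ^ n * b ^ (m + 2)) *
            (Real.log j ^ m * (1 / (j : ℝ) + 1 / ((n : ℝ) - j)))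
          + (a * b ^ (m + 1) + (-1 : ℝ) ^ n * (a ^ (m + 1) * b)) *
            ((-1 : ℝ) ^ j * (Real.log j ^ m * (1 / (j : ℝ) + 1 / ((n : ℝ) - j))))) := by
  obtain ⟨i, rfl⟩ : ∃ i, n = j + i := ⟨n - j, by omega⟩
  have hi : (0 : ℝ) < i := by exact_mod_cast (by omega : 0 < i)
  have hj' : (0 : ℝ) < j := by exact_mod_cast hj
  have hs : (-1 : ℝ) ^ j * (-1 : ℝ) ^ j = 1 := by
    rw [← mul_pow]; norm_num
  have hpf : 1 / (j : ℝ) + 1 / (i : ℝ) = (j + i) / (j * i) := by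
    field_simp
    ring
  simp only [Bfun, Nat.add_sub_cancel, Nat.add_sub_cancel_left, Nat.sub_self, Nat.factorial_zero,
    Nat.cast_one, Nat.cast_add, add_sub_cancel_left, pow_zero, pow_one, mul_one, div_one]
  rw [hpf]
  generalize Real.log j ^ m = l
  simp only [pow_add, pow_one]
  generalize (-1 : ℝ) ^ j = s at *
  generalize (-1 : ℝ) ^ i = t
  have hji : (j : ℝ) + i ≠ 0 := by positivity
  field_simp
  linear_combination (-(a ^ m * a * b * t * l * Real.sqrt q ^ j * Real.sqrt q ^ i)) * hs

/-- Lemma 5.8: the convolution sum of the bias terms. -/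
theorem statement_13 :
    ∃ C : ℝ, 0 < C ∧
      ∀ q d a b : ℝ,
        2 ≤ q → 1 ≤ d → |a| ≤ d → |b| ≤ d →
        ∀ k n : ℕ, 2 ≤ k → 4 ≤ n →
          |(∑ p ∈ (Finset.Icc 2 n ×ˢ Finset.Icc 2 n).filter (fun p => p.1 + p.2 = n),
              Bfun q a b (k - 1) p.1 * Bfun q a b 1 p.2)
            - ((-1 : ℝ) ^ k * k / (Nat.factorial (k - 1) : ℝ)) *
                (a ^ k + (-1 : ℝ) ^ n * b ^ k) * Real.sqrt q ^ n * Real.log n ^ (k - 1) / n|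
          ≤ C * d ^ k * (k : ℝ) ^ 2 / Nat.factorial (k - 1) *
              Real.sqrt q ^ n * Real.log n ^ (k - 2) / n := by
  refine ⟨26, by norm_num, ?_⟩
  intro q d a b _ hd ha hb k n hk hn
  obtain ⟨m, rfl⟩ : ∃ m, k = m + 2 := ⟨k - 2, by omega⟩
  have hd0 : 0 ≤ d := by linarith
  have hL : 1 ≤ Real.log n := one_le_log_natCast hn
  have hn0 : (0 : ℝ) < n := by exact_mod_cast (by omega : 0 < n)
  have h1 := abs_sum_log_pow_div_sub_le m hn
  have h2 := abs_sum_log_pow_div_reflect_sub_le m hn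
  have h3 := abs_alternating_sum_log_pow_le m hn
  rw [sum_filter_add_eq_sum_Ico (fun x y => Bfun q a b (m + 2 - 1) x * Bfun q a b 1 y) n]
  rw [show m + 2 - 1 = m + 1 by omega, show m + 2 - 2 = m by omega]
  rw [Finset.sum_congr rfl fun j hj => Bfun_mul_Bfun_one q a b m (n := n) (j := j)
      (by rw [Finset.mem_Ico] at hj; omega) (by rw [Finset.mem_Ico] at hj; omega),
    ← Finset.mul_sum, Finset.sum_add_distrib, ← Finset.mul_sum, ← Finset.mul_sum]
  have hS : ∑ j ∈ Finset.Ico 2 (n - 1), Real.log j ^ m * (1 / (j : ℝ) + 1 / ((n : ℝ) - j))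
      = ∑ j ∈ Finset.Ico 2 (n - 1), Real.log j ^ m / j
        + ∑ j ∈ Finset.Ico 2 (n - 1), Real.log j ^ m / ((n : ℝ) - j) := by
    rw [← Finset.sum_add_distrib]
    exact Finset.sum_congr rfl fun j _ => by ring
  rw [hS]
  clear hS
  generalize ∑ j ∈ Finset.Ico 2 (n - 1), Real.log j ^ m / (j : ℝ) = S₁ at *
  generalize ∑ j ∈ Finset.Ico 2 (n - 1), Real.log j ^ m / ((n : ℝ) - j) = S₂ at *
  generalize ∑ j ∈ Finset.Ico 2 (n - 1),
    (-1 : ℝ) ^ j * (Real.log j ^ m * (1 / (j : ℝ) + 1 / ((n : ℝ) - j))) = T at *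
  generalize Real.log n = L at *
  have hab : ∀ r s : ℕ, |a ^ r * b ^ s| ≤ d ^ (r + s) := fun r s => by
    rw [abs_mul, abs_pow, abs_pow, pow_add]
    gcongr
  have hsgn : ∀ x : ℝ, |(-1 : ℝ) ^ n * x| = |x| := fun x => by
    rw [abs_mul, abs_pow, abs_neg, abs_one, one_pow, one_mul]
  have hA : |a ^ (m + 2) + (-1 : ℝ) ^ n * b ^ (m + 2)| ≤ 2 * d ^ (m + 2) := by
    have e1 := hab (m + 2) 0
    have e2 := hab 0 (m + 2)
    rw [pow_zero, mul_one, add_zero] at e1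
    rw [pow_zero, one_mul, zero_add] at e2
    have := abs_add_le (a ^ (m + 2)) ((-1 : ℝ) ^ n * b ^ (m + 2))
    rw [hsgn] at this
    linarith
  have hB : |a * b ^ (m + 1) + (-1 : ℝ) ^ n * (a ^ (m + 1) * b)| ≤ 2 * d ^ (m + 2) := by
    have e1 := hab 1 (m + 1)
    have e2 := hab (m + 1) 1
    rw [show 1 + (m + 1) = m + 2 by omega, pow_one] at e1
    rw [show m + 1 + 1 = m + 2 by omega, pow_one] at e2
    have := abs_add_le (a * b ^ (m + 1)) ((-1 : ℝ) ^ n * (a ^ (m + 1) * b))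
    rw [hsgn] at this
    linarith
  generalize a ^ (m + 2) + (-1 : ℝ) ^ n * b ^ (m + 2) = A at *
  generalize a * b ^ (m + 1) + (-1 : ℝ) ^ n * (a ^ (m + 1) * b) = B at *
  set W : ℝ := Real.sqrt q ^ n / (Nat.factorial m * n) with hW
  have hW0 : 0 ≤ W := by positivity
  have hLm : 0 ≤ L ^ m := by positivity
  have hdk : 0 ≤ d ^ (m + 2) := by positivity
  have hE : (-1 : ℝ) ^ m / (Nat.factorial m : ℝ) * Real.sqrt q ^ n / n * (A * (S₁ + S₂) + B * T)
        - (-1 : ℝ) ^ (m + 2) * ((m + 2 : ℕ) : ℝ) / (Nat.factorial (m + 1) : ℝ) * A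
          * Real.sqrt q ^ n * L ^ (m + 1) / n
      = (-1 : ℝ) ^ m * (W *
        (A * ((S₁ - L ^ (m + 1) / (m + 1)) + (S₂ - L ^ (m + 1))) + B * T)) := by
    rw [hW, Nat.factorial_succ]
    push_cast
    field_simp
    ring
  rw [hE, abs_mul, abs_pow, abs_neg, abs_one, one_pow, one_mul, abs_mul, abs_of_nonneg hW0]
  have hAS : |A * ((S₁ - L ^ (m + 1) / (m + 1)) + (S₂ - L ^ (m + 1)))|
      ≤ 2 * d ^ (m + 2) * (9 * (m + 1) * L ^ m) := by
    rw [abs_mul]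
    gcongr
    exact (abs_add_le _ _).trans (by linarith)
  have hBT : |B * T| ≤ 2 * d ^ (m + 2) * (4 * (m + 1) * L ^ m) := by
    rw [abs_mul]
    gcongr
  calc W * |A * ((S₁ - L ^ (m + 1) / (m + 1)) + (S₂ - L ^ (m + 1))) + B * T|
      ≤ W * (26 * d ^ (m + 2) * (m + 1) * L ^ m) := by
        gcongr
        exact (abs_add_le _ _).trans (by linarith)
    _ = 26 * d ^ (m + 2) * ((m : ℝ) + 1) ^ 2 / Nat.factorial (m + 1) *
          Real.sqrt q ^ n * L ^ m / n := by
        rw [hW, Nat.factorial_succ]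
        push_cast
        field_simp
    _ ≤ _ := by
        push_cast
        gcongr
        norm_num

end
end

section
/- Let 𝔽_q be a finite field with q elements and let c ≥ 0 be a real number. Then there exist a constant C ≥ 0 and a sequence (M_n)_{n≥1} of squarefree monic polynomials in 𝔽_q[t] such that deg M_n → ∞ as n → ∞ and |τ(M_n) − c·deg M_n| ≤ C for all n, where τ(M) denotes the number of monic divisors of M. -/
noncomputable section

open Polynomial in
theorem exists_monic_irreducible_natDegree_eq (F : Type*) [Field F] [Finite F] {n : ℕ}
    (hn : n ≠ 0) : ∃ P : F[X], P.Monic ∧ Irreducible P ∧ P.natDegree = n := by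
  obtain ⟨p, _⟩ := CharP.exists F
  have : Fact p.Prime := ⟨CharP.char_is_prime F p⟩
  have : NeZero n := ⟨hn⟩
  obtain ⟨α, hα⟩ := Field.exists_primitive_element F (FiniteField.Extension F p n)
  have hint : IsIntegral F α := .of_finite F α
  refine ⟨minpoly F α, minpoly.monic hint, minpoly.irreducible hint, ?_⟩
  rw [← IntermediateField.adjoin.finrank hint, hα, IntermediateField.finrank_top',
    FiniteField.finrank_extension]

open Polynomial in
theorem ncard_monic_dvd_irreducible_mul {F : Type*} [Field F] {P A : F[X]} (hP : P.Monic)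
    (hPi : Irreducible P) (hPA : ¬ P ∣ A) (hfin : {D : F[X] | D.Monic ∧ D ∣ A}.Finite) :
    {D : F[X] | D.Monic ∧ D ∣ P * A}.ncard = 2 * {D : F[X] | D.Monic ∧ D ∣ A}.ncard := by
  have hunion : {D : F[X] | D.Monic ∧ D ∣ P * A} =
      {D : F[X] | D.Monic ∧ D ∣ A} ∪ (P * ·) '' {D : F[X] | D.Monic ∧ D ∣ A} := by
    ext D
    simp only [Set.mem_union, Set.mem_image, Set.mem_ofPred_eq]
    constructor
    · rintro ⟨hD, hdvd⟩
      by_cases h : P ∣ D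
      · obtain ⟨E, rfl⟩ := h
        exact .inr ⟨E, ⟨hP.of_mul_monic_left hD, (mul_dvd_mul_iff_left hPi.ne_zero).1 hdvd⟩, rfl⟩
      · exact .inl ⟨hD, (hPi.coprime_iff_not_dvd.2 h).symm.dvd_of_dvd_mul_left hdvd⟩
    · rintro (⟨hD, hdvd⟩ | ⟨E, ⟨hE, hdvd⟩, rfl⟩)
      · exact ⟨hD, hdvd.mul_left P⟩
      · exact ⟨hP.mul hE, mul_dvd_mul_left P hdvd⟩
  have hdisj : Disjoint {D : F[X] | D.Monic ∧ D ∣ A}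
      ((P * ·) '' {D : F[X] | D.Monic ∧ D ∣ A}) := by
    rw [Set.disjoint_left]
    rintro _ ⟨-, hD⟩ ⟨E, -, rfl⟩
    exact hPA ((dvd_mul_right P E).trans hD)
  rw [hunion, Set.ncard_union_eq hdisj hfin (hfin.image _),
    Set.ncard_image_of_injective _ (mul_right_injective₀ hPi.ne_zero), two_mul]

open Polynomial in
theorem squarefree_irreducible_mul {F : Type*} [Field F] {P A : F[X]}
    (hPi : Irreducible P) (hPA : ¬ P ∣ A) (hA : Squarefree A) : Squarefree (P * A) :=
  squarefree_mul_iff.2 ⟨(hPi.coprime_iff_not_dvd.2 hPA).isRelPrime, hPi.squarefree, hA⟩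

open Polynomial in
theorem exists_squarefree_natDegree_le_sq (F : Type*) [Field F] [Finite F] (k : ℕ) :
    ∃ A : F[X], A.Monic ∧ Squarefree A ∧ A.natDegree ≤ k ^ 2 ∧
      (∀ P : F[X], Irreducible P → P ∣ A → P.natDegree ≤ k) ∧
      {D : F[X] | D.Monic ∧ D ∣ A}.ncard = 2 ^ k := by
  induction k with
  | zero =>
    refine ⟨1, monic_one, squarefree_one, by simp, fun P hP h => absurd (isUnit_of_dvd_one h)
      hP.not_isUnit, ?_⟩
    rw [pow_zero, Set.ncard_eq_one]
    refine ⟨1, Set.ext fun D => ⟨fun h => h.1.eq_one_of_isUnit (isUnit_of_dvd_one h.2), ?_⟩⟩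
    rintro rfl
    exact ⟨monic_one, dvd_rfl⟩
  | succ k ih =>
    obtain ⟨A, hA, hsq, hdeg, hirr, hcard⟩ := ih
    obtain ⟨P, hP, hPi, hPdeg⟩ := exists_monic_irreducible_natDegree_eq F k.succ_ne_zero
    have hPA : ¬ P ∣ A := fun h => by have := hirr P hPi h; omega
    refine ⟨P * A, hP.mul hA, squarefree_irreducible_mul hPi hPA hsq, ?_, fun Q hQ hdvd => ?_, ?_⟩
    · rw [hP.natDegree_mul hA, hPdeg]
      nlinarith
    · rcases hQ.prime.dvd_or_dvd hdvd with h | h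
      · exact (natDegree_le_of_dvd h hPi.ne_zero).trans hPdeg.le
      · exact (hirr Q hQ h).trans k.le_succ
    · rw [ncard_monic_dvd_irreducible_mul hP hPi hPA
        (Set.finite_of_ncard_pos (hcard ▸ by positivity)), hcard, pow_succ']

open Polynomial in
theorem exists_squarefree_natDegree_eq_ncard_eq (F : Type*) [Field F] [Finite F] {k d : ℕ}
    (hd : k ^ 2 + k < d) :
    ∃ M : F[X], M.Monic ∧ Squarefree M ∧ M.natDegree = d ∧
      {D : F[X] | D.Monic ∧ D ∣ M}.ncard = 2 ^ (k + 1) := by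
  obtain ⟨A, hA, hsq, hdeg, hirr, hcard⟩ := exists_squarefree_natDegree_le_sq F k
  obtain ⟨P, hP, hPi, hPdeg⟩ := exists_monic_irreducible_natDegree_eq F
    (n := d - A.natDegree) (by omega)
  have hPA : ¬ P ∣ A := fun h => by have := hirr P hPi h; omega
  refine ⟨P * A, hP.mul hA, squarefree_irreducible_mul hPi hPA hsq, ?_, ?_⟩
  · rw [hP.natDegree_mul hA, hPdeg]
    omega
  · rw [ncard_monic_dvd_irreducible_mul hP hPi hPA
      (Set.finite_of_ncard_pos (hcard ▸ by positivity)), hcard, pow_succ']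

theorem exists_forall_sq_add_lt_floor_two_pow_div {c : ℝ} (hc : 0 < c) :
    ∃ N : ℕ, ∀ k ≥ N, k ^ 2 + k < ⌊(2 : ℝ) ^ (k + 1) / c⌋₊ := by
  have hlim := tendsto_pow_const_div_const_pow_of_one_lt 2 (one_lt_two (α := ℝ))
  have hev := (hlim.eventually_lt_const (show (0 : ℝ) < 2 / (3 * c) by positivity)).and
    (Filter.eventually_ge_atTop 1)
  obtain ⟨N, hN⟩ := Filter.eventually_atTop.1 hev
  refine ⟨N, fun k hk => ?_⟩
  obtain ⟨hlt, hk1⟩ := hN k hk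
  have hk1' : (1 : ℝ) ≤ k := by exact_mod_cast hk1
  rw [div_lt_div_iff₀ (by positivity) (by positivity)] at hlt
  refine Nat.lt_of_succ_le (Nat.le_floor ?_)
  rw [le_div_iff₀ hc, pow_succ (2 : ℝ)]
  push_cast
  have : ((k : ℝ) ^ 2 + k + 1) * c ≤ 3 * (k : ℝ) ^ 2 * c := by
    gcongr
    nlinarith
  linarith

/-- Lemma 4.4: for any `c ≥ 0` there is a sequence of squarefree monic
polynomials `Mₙ ∈ 𝔽_q[t]` with `deg Mₙ → ∞` and `τ(Mₙ) = c · deg Mₙ + O(1)`, where `τ(M)`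
is the number of monic divisors of `M`. -/
theorem statement_15 {Fq : Type} [Field Fq] [Fintype Fq] (c : ℝ) (hc : 0 ≤ c) :
    ∃ C : ℝ, 0 ≤ C ∧
      ∃ M : ℕ → Polynomial Fq,
        (∀ n, Squarefree (M n) ∧ (M n).Monic) ∧
        Filter.Tendsto (fun n => (M n).natDegree) Filter.atTop Filter.atTop ∧
        ∀ n, |(Set.ncard {D : Polynomial Fq | D.Monic ∧ D ∣ M n} : ℝ)
                - c * (M n).natDegree| ≤ C := by
  rcases hc.eq_or_lt with rfl | hc
  · choose M hM hsq hdeg hcard using fun n : ℕ =>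
      exists_squarefree_natDegree_eq_ncard_eq Fq (k := 0) (d := n + 1) (by omega)
    refine ⟨2, by norm_num, M, fun n => ⟨hsq n, hM n⟩, ?_, fun n => by simp [hcard]⟩
    simpa only [hdeg] using Filter.tendsto_add_atTop_nat 1
  · obtain ⟨N, hN⟩ := exists_forall_sq_add_lt_floor_two_pow_div hc
    choose M hM hsq hdeg hcard using fun n : ℕ =>
      exists_squarefree_natDegree_eq_ncard_eq Fq (hN (n + N) (Nat.le_add_left N n))
    refine ⟨c, hc.le, M, fun n => ⟨hsq n, hM n⟩, ?_, fun n => ?_⟩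
    · refine Filter.tendsto_atTop_mono (fun n => ?_) Filter.tendsto_id
      have := hN (n + N) (Nat.le_add_left N n)
      rw [hdeg, id]
      exact (Nat.le_add_right n N).trans ((Nat.le_add_left _ _).trans this.le)
    · rw [hcard, hdeg]
      set x : ℝ := (2 : ℝ) ^ (n + N + 1) / c with hx
      have hxc : (2 : ℝ) ^ (n + N + 1) = c * x := by rw [hx]; field_simp
      have h1 := Nat.floor_le (show 0 ≤ x by positivity)
      have h2 := Nat.lt_floor_add_one x
      push_cast
      rw [hxc, ← mul_sub, abs_of_nonneg (mul_nonneg hc.le (by linarith))]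
      nlinarith

end
end

section
/- Let θ ∈ ℝ satisfy cos θ = −1/(2√5). Then θ is not a rational multiple of π; that is, there is no rational number r with θ = rπ. -/
/-- if `cos θ = -1/(2√5)`, then `θ` is not a rational multiple of `π`. -/
theorem statement_19 (θ : ℝ) (hθ : Real.cos θ = -1 / (2 * Real.sqrt 5)) :
    ¬∃ r : ℚ, θ = (r : ℝ) * Real.pi := by
  rintro ⟨r, hr⟩
  have hcos : Real.cos (2 * θ) = -9 / 10 := by
    rw [Real.cos_two_mul, hθ, div_pow, mul_pow, Real.sq_sqrt (by norm_num)]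
    norm_num
  have hmem := niven (θ := 2 * θ) ⟨2 * r, by rw [hr]; push_cast; ring⟩
    ⟨-9 / 10, by rw [hcos]; norm_num⟩
  rw [hcos] at hmem
  norm_num at hmem
end
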